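/- arXiv:1005.0129 — 4 statements merged into one kernel-verified Lean document; each statement's English description precedes it below -/
import Mathlib

section
/- For every integer n ≥ 4, the automaton 𝒟'_n is synchronizing and its reset length (the minimum length of a reset word) is exactly n² − 3n + 4. -/
/-- The two input letters of the automaton. -/
inductive Letter | a | b

/-- Transition function of the automaton `𝒟'ₙ` on states `{1, …, n}`:
`δ(i,a) = δ(i,b) = i+1` for `1 ≤ i ≤ n-2`, `δ(n-1,a) = 1`, `δ(n-1,b) = n`,
`δ(n,a) = 2`, `δ(n,b) = 1`. -/
def delta (n : ℕ) (q : ℕ) : Letter → ℕ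
  | Letter.a => if q < n - 1 then q + 1 else if q = n - 1 then 1 else 2
  | Letter.b => if q < n - 1 then q + 1 else if q = n - 1 then n else 1

/-- `w` is a reset word: it sends every state in `{1, …, n}` to one single state. -/
def IsReset (n : ℕ) (w : List Letter) : Prop :=
  ∃ p : ℕ, ∀ q ∈ Finset.Icc 1 n, w.foldl (delta n) q = p

/-! ### A reset word of the required length -/

lemma foldl_replicate_b_of_le {n : ℕ} (hn : 4 ≤ n) (k q : ℕ) (hq : 1 ≤ q) (h : q + k ≤ n) :
    (List.replicate k Letter.b).foldl (delta n) q = q + k := by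
  induction k generalizing q with
  | zero => simp
  | succ k ih =>
    have hd : delta n q Letter.b = q + 1 := by
      simp only [delta]; split_ifs <;> omega
    rw [List.replicate_succ, List.foldl_cons, hd, ih _ (by omega) (by omega)]
    omega

lemma foldl_replicate_b_of_gt {n : ℕ} (hn : 4 ≤ n) (k q : ℕ) (hq : 1 ≤ q) (hqn : q ≤ n)
    (hk : k ≤ n) (h : n < q + k) :
    (List.replicate k Letter.b).foldl (delta n) q = q + k - n := by
  obtain ⟨j, rfl⟩ : ∃ j, k = (n - q) + (1 + j) := ⟨k - (n - q) - 1, by omega⟩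
  have hd : delta n n Letter.b = 1 := by
    simp only [delta]; split_ifs <;> omega
  rw [List.replicate_add, List.foldl_append,
    foldl_replicate_b_of_le hn (n - q) q hq (by omega), List.replicate_add, List.foldl_append,
    show q + (n - q) = n by omega]
  simp only [List.replicate_one, List.foldl_cons, List.foldl_nil, hd]
  rw [foldl_replicate_b_of_le hn _ _ le_rfl (by omega)]
  omega

/-- The word `a bⁿ⁻²`, which fixes `n - 1` and `n` and moves every other state one step down,
with `1` going to `n`. -/
def descent (n : ℕ) : List Letter := Letter.a :: List.replicate (n - 2) Letter.b

lemma foldl_descent {n : ℕ} (hn : 4 ≤ n) (q : ℕ) (hq : 1 ≤ q) (hqn : q ≤ n) :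
    (descent n).foldl (delta n) q = if n - 1 ≤ q then q else if q = 1 then n else q - 1 := by
  rw [descent, List.foldl_cons]
  have hd : delta n q Letter.a = if q < n - 1 then q + 1 else if q = n - 1 then 1 else 2 := rfl
  rw [hd]
  split_ifs <;>
    first
    | omega
    | (rw [foldl_replicate_b_of_le hn _ _ (by omega) (by omega)]; omega)
    | (rw [foldl_replicate_b_of_gt hn _ _ (by omega) (by omega) (by omega) (by omega)]; omega)

lemma foldl_descent_iterate {n : ℕ} (hn : 4 ≤ n) (k q : ℕ) (hq : 1 ≤ q) (hqn : q ≤ n) :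
    (List.replicate k (descent n)).flatten.foldl (delta n) q =
      if n - 1 ≤ q then q else if q ≤ k then n else q - k := by
  induction k generalizing q with
  | zero => simp; omega
  | succ k ih =>
    rw [List.replicate_succ, List.flatten_cons, List.foldl_append, foldl_descent hn q hq hqn]
    split_ifs <;> (rw [ih _ (by omega) (by omega)]; split_ifs <;> omega)

lemma exists_isReset {n : ℕ} (hn : 4 ≤ n) :
    ∃ w : List Letter, IsReset n w ∧ w.length = n ^ 2 - 3 * n + 4 := by
  refine ⟨(List.replicate (n - 2) (descent n)).flatten ++ [Letter.b, Letter.a], ⟨2, ?_⟩, ?_⟩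
  · intro q hq
    rw [Finset.mem_Icc] at hq
    rw [List.foldl_append, foldl_descent_iterate hn _ q hq.1 hq.2]
    simp only [List.foldl_cons, List.foldl_nil, delta]
    grind
  · obtain ⟨m, rfl⟩ : ∃ m, n = m + 4 := ⟨n - 4, by omega⟩
    have h : (m + 4) ^ 2 - 3 * (m + 4) = m ^ 2 + 5 * m + 4 := by
      rw [Nat.sub_eq_iff_eq_add (by nlinarith)]; ring
    simp [descent, h]
    ring

/-! ### The lift to the integers and the lower bound -/

/-- The lift of `delta n` to `ℤ`, viewed as an infinite cover of the cycle of length `n`: every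
letter moves one step forward, except that `a` jumps two steps from positions congruent to
`-1` or `0` modulo `n`. -/
def liftStep (n x : ℤ) : Letter → ℤ
  | Letter.a => if n ∣ x ∨ n ∣ x + 1 then x + 2 else x + 1
  | Letter.b => x + 1

/-- The number of two-step jumps made by the lift of `w` started at `x`. -/
def jumps (n : ℤ) (w : List Letter) (x : ℤ) : ℤ := w.foldl (liftStep n) x - x - w.length

lemma foldl_liftStep (n : ℤ) (w : List Letter) (x : ℤ) :
    w.foldl (liftStep n) x = x + w.length + jumps n w x := by
  unfold jumps; ring

lemma jumps_append (n : ℤ) (u v : List Letter) (x : ℤ) :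
    jumps n (u ++ v) x = jumps n u x + jumps n v (u.foldl (liftStep n) x) := by
  simp only [jumps, List.foldl_append, List.length_append]; push_cast; ring

lemma jumps_cons (n : ℤ) (l : Letter) (w : List Letter) (x : ℤ) :
    jumps n (l :: w) x = (liftStep n x l - x - 1) + jumps n w (liftStep n x l) := by
  simp only [jumps, List.foldl_cons, List.length_cons]; push_cast; ring

lemma jumps_nonneg (n : ℤ) (w : List Letter) (x : ℤ) : 0 ≤ jumps n w x := by
  induction w generalizing x with
  | nil => simp [jumps]
  | cons l w ih =>
    rw [jumps_cons]
    have h := ih (liftStep n x l)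
    have : x + 1 ≤ liftStep n x l := by
      cases l <;> simp only [liftStep]
      · split_ifs <;> omega
      · omega
    omega

/-- At most one jump happens per lap, so `J` jumps take the lift through `J` full laps. -/
lemma laps_le_foldl_liftStep {n : ℤ} (hn : 0 < n) (w : List Letter) (x c : ℤ)
    (hx : n * c + 1 ≤ x) : n * (c + jumps n w x) + 1 ≤ x + w.length + jumps n w x := by
  induction w generalizing x c with
  | nil => simpa [jumps] using hx
  | cons l w ih =>
    rw [jumps_cons]
    have hstep : liftStep n x l = x + 1 ∨
        liftStep n x l = x + 2 ∧ n * (c + 1) + 1 ≤ x + 2 := by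
      cases l
      · simp only [liftStep]
        split_ifs with h
        · refine Or.inr ⟨rfl, ?_⟩
          rcases h with ⟨d, hd⟩ | ⟨d, hd⟩ <;>
          · have : c < d := by
              by_contra! hcd
              nlinarith
            nlinarith
        · exact Or.inl rfl
      · exact Or.inl rfl
    rcases hstep with h | ⟨h, hc⟩
    · rw [h]
      have := ih (x + 1) c (by omega)
      rw [List.length_cons]
      push_cast
      ring_nf at this ⊢
      linarith
    · rw [h]
      have := ih (x + 2) (c + 1) hc
      rw [List.length_cons]
      push_cast
      ring_nf at this ⊢
      linarith

lemma delta_lift {n : ℕ} (hn : 4 ≤ n) (q : ℕ) (x : ℤ) (l : Letter) (hq : 1 ≤ q) (hqn : q ≤ n)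
    (hx : (n : ℤ) ∣ x - q) :
    (1 ≤ delta n q l ∧ delta n q l ≤ n) ∧ (n : ℤ) ∣ liftStep n x l - delta n q l := by
  have hjump : ((n : ℤ) ∣ x ∨ (n : ℤ) ∣ x + 1) ↔ n - 1 ≤ q := by
    have hzero : (n : ℤ) ∣ x ↔ n ∣ q := by
      rw [← Int.natCast_dvd_natCast]; exact (dvd_iff_dvd_of_dvd_sub hx)
    have hone : (n : ℤ) ∣ x + 1 ↔ n ∣ q + 1 := by
      rw [← Int.natCast_dvd_natCast]
      exact (dvd_iff_dvd_of_dvd_sub (by push_cast; ring_nf at hx ⊢; exact hx))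
    rw [hzero, hone]
    constructor
    · rintro (h | h) <;> have := Nat.le_of_dvd (by omega) h <;> omega
    · intro h
      rcases (by omega : q = n ∨ q + 1 = n) with h | h
      · exact Or.inl (by rw [h])
      · exact Or.inr (by rw [h])
  obtain ⟨d, hd⟩ := hx
  cases l
  · simp only [liftStep, delta, hjump]
    refine ⟨by split_ifs <;> omega, ?_⟩
    split_ifs <;>
      first
      | omega
      | exact ⟨d, by push_cast; linarith⟩
      | exact ⟨d + 1, by
          rw [mul_add, ← hd]
          push_cast
          omega⟩
  · simp only [liftStep, delta]
    refine ⟨by split_ifs <;> omega, ?_⟩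
    split_ifs <;>
      first
      | exact ⟨d, by push_cast; omega⟩
      | exact ⟨d + 1, by
          rw [mul_add, ← hd]
          push_cast
          omega⟩

lemma foldl_delta_lift {n : ℕ} (hn : 4 ≤ n) (w : List Letter) (q : ℕ) (x : ℤ) (hq : 1 ≤ q)
    (hqn : q ≤ n) (hx : (n : ℤ) ∣ x - q) :
    (n : ℤ) ∣ w.foldl (liftStep n) x - w.foldl (delta n) q := by
  induction w generalizing q x with
  | nil => simpa using hx
  | cons l w ih =>
    obtain ⟨⟨h₁, h₂⟩, h₃⟩ := delta_lift hn q x l hq hqn hx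
    exact ih _ _ h₁ h₂ h₃

/-- A reset word drags some position a full lap ahead of its predecessor. -/
lemma exists_jumps_gap {n : ℕ} (hn : 4 ≤ n) {w : List Letter} (hw : IsReset n w) :
    ∃ x : ℤ, 1 ≤ x ∧ x ≤ n ∧ jumps n w x + n - 1 ≤ jumps n w (x + 1) ∧
      (n : ℤ) ∣ w.foldl (liftStep n) (x + 1) - w.foldl (liftStep n) x := by
  obtain ⟨p, hp⟩ := hw
  have hres (k : ℕ) (hk : k ≤ n) :
      (n : ℤ) ∣ w.foldl (liftStep n) ((k : ℤ) + 1) - p := by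
    rcases hk.lt_or_eq with hk | rfl
    · rw [← hp (k + 1) (Finset.mem_Icc.2 ⟨by omega, by omega⟩)]
      exact foldl_delta_lift hn w _ _ (by omega) (by omega) (by simp)
    · rw [← hp 1 (Finset.mem_Icc.2 ⟨by omega, by omega⟩)]
      exact foldl_delta_lift hn w _ _ (by omega) (by omega) (by simp)
  have hperiod : w.foldl (liftStep n) ((n : ℤ) + 1) = w.foldl (liftStep n) 1 + n := by
    have key (w : List Letter) (y : ℤ) :
        w.foldl (liftStep n) (y + n) = w.foldl (liftStep n) y + n := by
      induction w generalizing y with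
      | nil => rfl
      | cons l w ih =>
        have : liftStep n (y + n) l = liftStep n y l + n := by
          cases l
          · have h : (n : ℤ) ∣ y + n + 1 ↔ (n : ℤ) ∣ y + 1 := by
              rw [add_right_comm, dvd_add_self_right]
            simp only [liftStep, dvd_add_self_right, h]
            split_ifs <;> ring
          · simp only [liftStep]; ring
        simp only [List.foldl_cons, this, ih]
    rw [add_comm, key]
  obtain ⟨k, hkn, hk⟩ : ∃ k : ℕ, k < n ∧
      w.foldl (liftStep n) ((k : ℤ) + 1) < w.foldl (liftStep n) ((k : ℤ) + 1 + 1) := by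
    by_contra! hcon
    have hle (k : ℕ) (hk : k ≤ n) :
        w.foldl (liftStep n) ((k : ℤ) + 1) ≤ w.foldl (liftStep n) 1 := by
      induction k with
      | zero => simp
      | succ k ih =>
        have := hcon k (by omega)
        push_cast
        exact this.trans (ih (by omega))
    have := hle n le_rfl
    omega
  have hdvd : (n : ℤ) ∣ w.foldl (liftStep n) ((k : ℤ) + 1 + 1) -
      w.foldl (liftStep n) ((k : ℤ) + 1) := by
    have h := dvd_sub (hres (k + 1) (by omega)) (hres k hkn.le)
    push_cast at h
    simpa using h
  refine ⟨k + 1, by omega, by omega, ?_, hdvd⟩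
  have := Int.le_of_dvd (by omega) hdvd
  rw [foldl_liftStep, foldl_liftStep] at this
  omega

/-- The lower bound when the leading position starts at `n - 1` and the trailing one makes no
jump. -/
lemma le_length_of_no_jump {n : ℤ} (hn : 4 ≤ n) {w : List Letter} (hwne : w ≠ [])
    (hB : jumps n w (n - 2) = 0) (hA : n - 1 ≤ jumps n w (n - 1))
    (hdvd : n ∣ w.foldl (liftStep n) (n - 1) - w.foldl (liftStep n) (n - 2)) :
    n ^ 2 - 3 * n + 4 ≤ w.length := by
  by_contra! hlt
  have hlap := laps_le_foldl_liftStep (n := n) (by omega) w (n - 1) 0 (by omega)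
  have hJ : jumps n w (n - 1) = n - 1 := by
    by_contra hne
    have : n ≤ jumps n w (n - 1) := by omega
    nlinarith
  have hlen : (w.length : ℤ) = n ^ 2 - 3 * n + 3 := by
    rw [hJ] at hlap; nlinarith
  obtain ⟨u, l, rfl⟩ := List.eq_nil_or_concat w |>.resolve_left hwne
  rw [List.concat_eq_append] at *
  rw [foldl_liftStep, foldl_liftStep, hJ, hB, hlen] at hdvd
  rw [List.length_append] at hlen
  push_cast [List.length_singleton] at hlen
  rw [jumps_append] at hJ hB
  have hu := jumps_nonneg n u (n - 2)
  have hl := jumps_nonneg n [l] (u.foldl (liftStep n) (n - 2))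
  cases l
  · rw [foldl_liftStep] at hB hl
    have huz : jumps n u (n - 2) = 0 := by omega
    have hpos : n ∣ n - 2 + u.length + jumps n u (n - 2) := by
      rw [huz]
      exact ⟨n - 2, by linarith [hlen]⟩
    rw [jumps_cons, liftStep, if_pos (Or.inl hpos)] at hB
    have := jumps_nonneg n [] (n - 2 + u.length + jumps n u (n - 2) + 2)
    omega
  · have hlast : jumps n [Letter.b] (u.foldl (liftStep n) (n - 1)) = 0 := by
      simp [jumps, liftStep]
    have h := laps_le_foldl_liftStep (n := n) (by omega) u (n - 1) 0 (by omega)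
    rw [hlast] at hJ
    have : jumps n u (n - 1) = n - 1 := by omega
    rw [this] at h
    nlinarith

lemma le_length_of_isReset {n : ℕ} (hn : 4 ≤ n) {w : List Letter} (hw : IsReset n w) :
    (n : ℤ) ^ 2 - 3 * n + 4 ≤ w.length := by
  obtain ⟨x, hx₁, hxn, hJ, hdvd⟩ := exists_jumps_gap hn hw
  have hB := jumps_nonneg n w x
  have hn' : (4 : ℤ) ≤ n := by exact_mod_cast hn
  generalize (n : ℤ) = N at *
  by_contra! hlt
  have hlap := laps_le_foldl_liftStep (n := N) (by omega) w (x + 1) 0 (by omega)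
  have hB0 : jumps N w x = 0 := by
    by_contra hne
    have : N ≤ jumps N w (x + 1) := by omega
    nlinarith
  -- If the leading position reaches the next lap without jumping, the word is too long.
  have hlong (u v : List Letter) (huv : w = u ++ v) (hu : jumps N u (x + 1) = 0)
      (hpos : N + 1 ≤ x + 1 + u.length) : False := by
    subst huv
    rw [hB0, jumps_append N u v (x + 1), hu, foldl_liftStep, hu] at hJ
    have h := laps_le_foldl_liftStep (n := N) (by omega) v (x + 1 + u.length + 0) 1 (by omega)
    rw [List.length_append] at hlt
    push_cast at hlt
    nlinarith
  have hxN : x + 1 ≤ N := by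
    by_contra! h
    exact hlong [] w rfl (by simp [jumps]) (by simp; omega)
  have hx : N - 2 ≤ x := by
    by_contra! h
    nlinarith
  have hwne : w ≠ [] := by
    rintro rfl
    simp [jumps] at hJ
    omega
  have hjump (y : ℤ) (v : List Letter) (hy : N ∣ y ∨ N ∣ y + 1) :
      1 ≤ jumps N (Letter.a :: v) y := by
    rw [jumps_cons, liftStep, if_pos hy]
    have := jumps_nonneg N v (y + 2)
    omega
  rcases (by omega : x = N - 1 ∨ x = N - 2) with rfl | rfl
  · match w, hwne with
    | Letter.a :: v, _ =>
      have := hjump (N - 1) v (Or.inr (by simp))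
      omega
    | Letter.b :: v, _ =>
      exact hlong [Letter.b] v rfl (by simp [jumps, liftStep]) (by simp)
  · rw [show N - 2 + 1 = N - 1 by ring] at *
    exact absurd (le_length_of_no_jump hn' hwne hB0 (by omega) hdvd) (by omega)

/-- `𝒟'ₙ` is synchronizing and its reset length is exactly `n² - 3n + 4`. -/
theorem dprime_automaton_reset_length (n : ℕ) (hn : 4 ≤ n) :
    IsLeast {L : ℕ | ∃ w : List Letter, IsReset n w ∧ w.length = L}
      (n ^ 2 - 3 * n + 4) := by
  refine ⟨exists_isReset hn, ?_⟩
  rintro _ ⟨w, hw, rfl⟩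
  have h := le_length_of_isReset hn hw
  have h3 : 3 * n ≤ n ^ 2 := by nlinarith
  zify [h3]
  exact h
end

section
/- For every integer n ≥ 4, the word (a b^{n−2})^{n−2} b a, of length (n−1)(n−2) + 2 = n² − 3n + 4, is a reset word for the automaton 𝒟'_n. -/
/-- The word `(a b^{n-2})^{n-2} b a`. -/
def theWord (n : ℕ) : List Letter :=
  (List.replicate (n - 2) (Letter.a :: List.replicate (n - 2) Letter.b)).flatten
    ++ [Letter.b, Letter.a]

/-- The letter `b` acts as the cyclic shift of `{1, …, n}`. -/
theorem foldl_delta_replicate_b {n q k : ℕ} (hq : 1 ≤ q) (hqn : q ≤ n) (hk : k ≤ n) :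
    (List.replicate k Letter.b).foldl (delta n) q = if q + k ≤ n then q + k else q + k - n := by
  induction k with
  | zero => simp [hqn]
  | succ k ih =>
    rw [List.replicate_succ', List.foldl_append, ih (by omega)]
    simp only [List.foldl_cons, List.foldl_nil, delta]
    split_ifs <;> omega

/-- The block `a b^{n-2}` fixes `n - 1` and `n`, and sends `1 ↦ n` and `i ↦ i - 1` otherwise. -/
theorem foldl_delta_block {n q : ℕ} (hn : 4 ≤ n) (hq : 1 ≤ q) (hqn : q ≤ n) :
    (Letter.a :: List.replicate (n - 2) Letter.b).foldl (delta n) q =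
      if n - 1 ≤ q then q else if q = 1 then n else q - 1 := by
  have ha : 1 ≤ delta n q Letter.a ∧ delta n q Letter.a ≤ n := by
    simp only [delta]
    split_ifs <;> omega
  rw [List.foldl_cons, foldl_delta_replicate_b ha.1 ha.2 (by omega)]
  simp only [delta]
  split_ifs <;> omega

/-- The action of `m` consecutive blocks `a b^{n-2}`. -/
theorem foldl_delta_blocks {n q : ℕ} (hn : 4 ≤ n) (hq : 1 ≤ q) (hqn : q ≤ n) (m : ℕ) :
    (List.replicate m (Letter.a :: List.replicate (n - 2) Letter.b)).flatten.foldl (delta n) q =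
      if n - 1 ≤ q then q else if q ≤ m then n else q - m := by
  induction m with
  | zero =>
    simp only [List.replicate_zero, List.flatten_nil, List.foldl_nil]
    split_ifs <;> omega
  | succ m ih =>
    rw [List.replicate_succ', List.flatten_append, List.foldl_append, ih, List.flatten_singleton,
      foldl_delta_block hn (by split_ifs <;> omega) (by split_ifs <;> omega)]
    split_ifs <;> omega

/-- The word `(a b^{n-2})^{n-2} b a`, of length `(n-1)(n-2) + 2 = n² - 3n + 4`,
is a reset word for `𝒟'ₙ`. -/
theorem dprime_automaton_reset_word (n : ℕ) (hn : 4 ≤ n) :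
    (theWord n).length = n ^ 2 - 3 * n + 4 ∧ IsReset n (theWord n) := by
  constructor
  · obtain ⟨m, rfl⟩ := Nat.exists_eq_add_of_le hn
    have hsq : (4 + m) ^ 2 = (2 + m) * (2 + m + 1) + 2 + 3 * (4 + m) - 4 := by
      rw [eq_comm, Nat.sub_eq_iff_eq_add (by omega)]
      ring
    have hm : 4 + m - 2 = 2 + m := by omega
    have hpos : 2 ≤ (2 + m) * (2 + m + 1) := by nlinarith
    simp only [theWord, hm, List.length_append, List.length_flatten, List.map_replicate,
      List.sum_replicate, List.length_cons, List.length_replicate, List.length_nil, smul_eq_mul]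
    omega
  · refine ⟨2, fun q hq => ?_⟩
    obtain ⟨hq, hqn⟩ := Finset.mem_Icc.mp hq
    rw [theWord, List.foldl_append, foldl_delta_blocks hn hq hqn]
    simp only [List.foldl_cons, List.foldl_nil, delta]
    split_ifs <;> omega
end

section
/- For every integer n ≥ 4, every reset word for the automaton 𝒟'_n has length at least n² − 3n + 4. -/
theorem delta_mem_Icc {n q : ℕ} (hn : 4 ≤ n) (hq : q ∈ Finset.Icc 1 n) (c : Letter) :
    delta n q c ∈ Finset.Icc 1 n := by
  rw [Finset.mem_Icc] at *
  cases c <;> simp only [delta] <;> split_ifs <;> omega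

theorem foldl_delta_mem_Icc {n : ℕ} (hn : 4 ≤ n) (w : List Letter) {q : ℕ}
    (hq : q ∈ Finset.Icc 1 n) : w.foldl (delta n) q ∈ Finset.Icc 1 n := by
  induction w generalizing q with
  | nil => exact hq
  | cons c w ih => exact ih (delta_mem_Icc hn hq c)

/-- Two states with the same image under a letter are equal, unless that image is `2`. -/
theorem delta_eq_two_of_ne {n q r : ℕ} (hn : 4 ≤ n) (hq : q ∈ Finset.Icc 1 n)
    (hr : r ∈ Finset.Icc 1 n) (hne : q ≠ r) {c : Letter} (h : delta n q c = delta n r c) :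
    delta n q c = 2 := by
  rw [Finset.mem_Icc] at hq hr
  cases c <;> simp only [delta] at h ⊢ <;> split_ifs at h ⊢ <;> omega

/-- Every reset word has a prefix that sends all states to `2`. -/
theorem exists_reset_to_two {n : ℕ} (hn : 4 ≤ n) (w : List Letter) (hw : IsReset n w) :
    ∃ v : List Letter, v.length ≤ w.length ∧
      ∀ q ∈ Finset.Icc 1 n, v.foldl (delta n) q = 2 := by
  induction w using List.reverseRecOn with
  | nil =>
    obtain ⟨p, hp⟩ := hw
    have h1 := hp 1 (by rw [Finset.mem_Icc]; omega)
    have h2 := hp 2 (by rw [Finset.mem_Icc]; omega)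
    simp only [List.foldl_nil] at h1 h2
    omega
  | append_singleton w c ih =>
    by_cases hr : IsReset n w
    · obtain ⟨v, hv, h⟩ := ih hr
      exact ⟨v, hv.trans (by simp), h⟩
    · obtain ⟨p, hp⟩ := hw
      have h1 : 1 ∈ Finset.Icc 1 n := by rw [Finset.mem_Icc]; omega
      have hne : ∃ q ∈ Finset.Icc 1 n, w.foldl (delta n) q ≠ w.foldl (delta n) 1 := by
        by_contra! hall
        exact hr ⟨_, hall⟩
      obtain ⟨q, hq, hne⟩ := hne
      have hpq := hp q hq
      have hp1 := hp 1 h1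
      simp only [List.foldl_append, List.foldl_cons, List.foldl_nil] at hpq hp1
      have hp2 : p = 2 := hpq ▸ delta_eq_two_of_ne hn (foldl_delta_mem_Icc hn w hq)
        (foldl_delta_mem_Icc hn w h1) hne (hpq.trans hp1.symm)
      exact ⟨w ++ [c], le_rfl, hp2 ▸ hp⟩

/-- The length of a path from `q` to `2` is, up to the shift `2 - q`, a combination of the
cycle lengths `n` and `n - 1`. -/
theorem exists_length_add_eq {n : ℕ} (hn : 4 ≤ n) (u : List Letter) {q : ℕ}
    (hq : q ∈ Finset.Icc 1 n) (hu : u.foldl (delta n) q = 2) :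
    ∃ x y : ℕ, u.length + q = x * n + y * (n - 1) + 2 := by
  induction u generalizing q with
  | nil => exact ⟨0, 0, by simpa using hu⟩
  | cons c u ih =>
    obtain ⟨x, y, h⟩ := ih (delta_mem_Icc hn hq c) hu
    rw [Finset.mem_Icc] at hq
    have hx : (x + 1) * n = x * n + n := by ring
    have hy : (y + 1) * (n - 1) = y * (n - 1) + (n - 1) := by ring
    rw [List.length_cons]
    rcases lt_trichotomy q (n - 1) with hlt | rfl | hgt
    · refine ⟨x, y, ?_⟩
      cases c <;> simp only [delta, if_pos hlt] at h <;> omega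
    · cases c <;> simp only [delta, lt_irrefl, if_false, if_true] at h
      · exact ⟨x, y + 1, by omega⟩
      · exact ⟨x, y, by omega⟩
    · cases c <;> simp only [delta, if_neg hgt.not_gt, if_neg hgt.ne'] at h
      · exact ⟨x, y + 1, by omega⟩
      · exact ⟨x + 1, y, by omega⟩

/-- The Frobenius number of `m` and `m + 1` is not a combination of them. -/
theorem mul_succ_add_mul_add_one_ne (m x y : ℕ) :
    x * (m + 1) + y * m + m + 1 ≠ m ^ 2 := by
  intro h
  rcases le_or_gt m (x + y + 1) with hk | hk
  · nlinarith
  · nlinarith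

/-- Every letter sends some state to `1`. -/
theorem exists_delta_eq_one {n : ℕ} (hn : 4 ≤ n) (c : Letter) :
    ∃ q ∈ Finset.Icc 1 n, delta n q c = 1 := by
  cases c
  · exact ⟨n - 1, by rw [Finset.mem_Icc]; omega, by simp [delta]⟩
  · refine ⟨n, by rw [Finset.mem_Icc]; omega, ?_⟩
    simp only [delta]
    split_ifs <;> omega

/-- Every reset word for `𝒟'ₙ` has length at least `n² - 3n + 4`. -/
theorem dprime_automaton_lower_bound (n : ℕ) (hn : 4 ≤ n)
    (w : List Letter) (hw : IsReset n w) :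
    n ^ 2 - 3 * n + 4 ≤ w.length := by
  obtain ⟨v, hvw, hv⟩ := exists_reset_to_two hn w hw
  by_contra! hlt
  obtain ⟨u, hu⟩ : ∃ u, u = List.replicate (n ^ 2 - 3 * n + 3 - v.length) Letter.b ++ v :=
    ⟨_, rfl⟩
  have hlen : u.length = n ^ 2 - 3 * n + 3 := by
    rw [hu, List.length_append, List.length_replicate]
    omega
  have hreset : ∀ q ∈ Finset.Icc 1 n, u.foldl (delta n) q = 2 := by
    intro q hq
    rw [hu, List.foldl_append]
    exact hv _ (foldl_delta_mem_Icc hn _ hq)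
  cases u with
  | nil => simp at hlen
  | cons c u =>
    obtain ⟨q, hq, hqc⟩ := exists_delta_eq_one hn c
    have h := hreset q hq
    rw [List.foldl_cons, hqc] at h
    obtain ⟨x, y, hxy⟩ := exists_length_add_eq hn u (by rw [Finset.mem_Icc]; omega) h
    rw [List.length_cons] at hlen
    obtain ⟨m, rfl⟩ : ∃ m, n = m + 1 := ⟨n - 1, by omega⟩
    rw [Nat.add_sub_cancel] at hxy
    have hsq : (m + 1) ^ 2 = m ^ 2 + 2 * m + 1 := by ring
    have hm : 3 * m ≤ m ^ 2 := by nlinarith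
    have := mul_succ_add_mul_add_one_ne m x y
    omega
end

section
/- For every integer n ≥ 4, every state q of the automaton 𝒟'_n, and every nonempty word w over {a,b} with δ(q,w) = q, there exist non-negative integers α, β such that the length of w equals α·n + β·(n−1). -/
/-- Each letter advances the state by one, up to subtracting `n` or `n - 1`. -/
theorem delta_step (n : ℕ) (hn : 2 ≤ n) (q : ℕ) (hq : q ∈ Finset.Icc 1 n) (c : Letter) :
    delta n q c ∈ Finset.Icc 1 n ∧
      ∃ α β : ℕ, q + 1 = delta n q c + (α * n + β * (n - 1)) := by
  rw [Finset.mem_Icc] at hq ⊢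
  have advance : ∀ r, (1 ≤ r ∧ r ≤ n) → (q + 1 = r ∨ q + 1 = r + n ∨ q + 1 = r + (n - 1)) →
      (1 ≤ r ∧ r ≤ n) ∧ ∃ α β : ℕ, q + 1 = r + (α * n + β * (n - 1)) := by
    rintro r hr (h | h | h)
    · exact ⟨hr, 0, 0, by simpa using h⟩
    · exact ⟨hr, 1, 0, by simpa using h⟩
    · exact ⟨hr, 0, 1, by simpa using h⟩
  cases c <;> apply advance <;> simp only [delta] <;> split_ifs <;> omega

/-- Reading a word advances the state by its length, up to subtracting a non-negative integer
combination of `n` and `n - 1`. -/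
theorem exists_add_length_eq_foldl_delta (n : ℕ) (hn : 2 ≤ n) (w : List Letter) (q : ℕ)
    (hq : q ∈ Finset.Icc 1 n) :
    ∃ α β : ℕ, q + w.length = w.foldl (delta n) q + (α * n + β * (n - 1)) := by
  induction w generalizing q with
  | nil => exact ⟨0, 0, by simp⟩
  | cons c w ih =>
    obtain ⟨hmem, α, β, hstep⟩ := delta_step n hn q hq c
    obtain ⟨α', β', hw⟩ := ih _ hmem
    refine ⟨α + α', β + β', ?_⟩
    rw [List.length_cons, List.foldl_cons, add_mul, add_mul]
    omega

/-- The length of any nonempty word labelling a cycle at a state of `𝒟'ₙ` is a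
non-negative integer combination of `n` and `n - 1`. -/
theorem dprime_cycle_lengths (n : ℕ) (hn : 4 ≤ n)
    (q : ℕ) (hq : q ∈ Finset.Icc 1 n)
    (w : List Letter) (hne : w ≠ []) (hcyc : w.foldl (delta n) q = q) :
    ∃ α β : ℕ, w.length = α * n + β * (n - 1) := by
  obtain ⟨α, β, h⟩ := exists_add_length_eq_foldl_delta n (by omega) w q hq
  exact ⟨α, β, by omega⟩
end
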